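/- Let n ≥ 2, m ≥ 2 and let B_1, ..., B_m be real symmetric n×n matrices. Then equality Σ_{r,s=1}^m ‖[B_r,B_s]‖² = (Σ_{r=1}^m ‖B_r‖²)² holds if and only if there exist P ∈ O(n), R ∈ O(m) and a real number μ ≥ 0 such that, setting C_s = Σ_{r=1}^m R_{rs} Pᵀ B_r P for each s, one has C_1 = H_1(μ), C_2 = H_2(μ), and C_s = 0 for all s ≥ 3, where H_1(μ) is the n×n symmetric matrix with (1,1)-entry μ, (2,2)-entry −μ and all other entries 0, and H_2(μ) is the n×n symmetric matrix with (1,2)- and (2,1)-entries equal to μ and all other entries 0. -/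

import Mathlib

open Matrix BigOperators

/-- Squared Frobenius norm of a real square matrix. -/
def frobSq {n : ℕ} (A : Matrix (Fin n) (Fin n) ℝ) : ℝ := ∑ i, ∑ j, (A i j) ^ 2

/-- Commutator of two square matrices. -/
def matComm {n : ℕ} (A B : Matrix (Fin n) (Fin n) ℝ) : Matrix (Fin n) (Fin n) ℝ :=
  A * B - B * A

/-- The matrix `H₁(μ)`: `(1,1)`-entry `μ`, `(2,2)`-entry `-μ`, all other entries `0`. -/
def H1 (n : ℕ) (μ : ℝ) : Matrix (Fin n) (Fin n) ℝ :=
  Matrix.of fun i j =>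
    if (i : ℕ) = 0 ∧ (j : ℕ) = 0 then μ
    else if (i : ℕ) = 1 ∧ (j : ℕ) = 1 then -μ
    else 0

/-- The matrix `H₂(μ)`: `(1,2)`- and `(2,1)`-entries `μ`, all other entries `0`. -/
def H2 (n : ℕ) (μ : ℝ) : Matrix (Fin n) (Fin n) ℝ :=
  Matrix.of fun i j =>
    if ((i : ℕ) = 0 ∧ (j : ℕ) = 1) ∨ ((i : ℕ) = 1 ∧ (j : ℕ) = 0) then μ
    else 0

lemma forall_eq_zero_of_sum_eq_zero {ι : Type*} [Fintype ι] {f : ι → ℝ} (hf : ∀ i, 0 ≤ f i)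
    (h : ∑ i, f i = 0) (i : ι) : f i = 0 :=
  (Finset.sum_eq_zero_iff_of_nonneg fun i _ => hf i).1 h i (Finset.mem_univ i)

/-- The Frobenius inner product of two real square matrices. -/
def frobInner {n : ℕ} (A B : Matrix (Fin n) (Fin n) ℝ) : ℝ := ∑ i, ∑ j, A i j * B i j

lemma frobSq_eq_frobInner {n : ℕ} (A : Matrix (Fin n) (Fin n) ℝ) :
    frobSq A = frobInner A A := by
  simp only [frobSq, frobInner, sq]

lemma frobInner_eq_trace {n : ℕ} (A B : Matrix (Fin n) (Fin n) ℝ) :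
    frobInner A B = (Aᵀ * B).trace := by
  simp only [frobInner, Matrix.trace, Matrix.diag, Matrix.mul_apply, Matrix.transpose_apply]
  exact Finset.sum_comm

lemma frobSq_nonneg {n : ℕ} (A : Matrix (Fin n) (Fin n) ℝ) : 0 ≤ frobSq A :=
  Finset.sum_nonneg fun _ _ => Finset.sum_nonneg fun _ _ => sq_nonneg _

lemma frobSq_eq_zero {n : ℕ} {A : Matrix (Fin n) (Fin n) ℝ} (h : frobSq A = 0) : A = 0 := by
  ext i j
  have h1 := forall_eq_zero_of_sum_eq_zero (fun j => sq_nonneg (A i j))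
    (forall_eq_zero_of_sum_eq_zero (fun i => Finset.sum_nonneg fun j _ => sq_nonneg (A i j)) h i) j
  simpa using h1

lemma frobSq_smul {n : ℕ} (a : ℝ) (A : Matrix (Fin n) (Fin n) ℝ) :
    frobSq (a • A) = a ^ 2 * frobSq A := by
  simp only [frobSq, Matrix.smul_apply, smul_eq_mul, mul_pow, Finset.mul_sum]

lemma frobInner_smul_smul {n : ℕ} (a b : ℝ) (A B : Matrix (Fin n) (Fin n) ℝ) :
    frobInner (a • A) (b • B) = a * b * frobInner A B := by
  simp only [frobInner, Matrix.smul_apply, smul_eq_mul, Finset.mul_sum]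
  exact Finset.sum_congr rfl fun _ _ => Finset.sum_congr rfl fun _ _ => by ring

lemma frobInner_sum_smul {n : ℕ} {ι κ : Type*} (s : Finset ι) (t : Finset κ) (a : ι → ℝ)
    (b : κ → ℝ) (A : ι → Matrix (Fin n) (Fin n) ℝ) (B : κ → Matrix (Fin n) (Fin n) ℝ) :
    frobInner (∑ r ∈ s, a r • A r) (∑ q ∈ t, b q • B q) =
      ∑ r ∈ s, ∑ q ∈ t, a r * b q * frobInner (A r) (B q) := by
  simp only [frobInner_eq_trace, Matrix.transpose_sum, Matrix.transpose_smul, Finset.sum_mul,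
    Finset.mul_sum, Matrix.trace_sum, smul_mul_smul_comm, Matrix.trace_smul, smul_eq_mul]
  exact Finset.sum_comm

lemma matComm_smul_smul {n : ℕ} (a b : ℝ) (A B : Matrix (Fin n) (Fin n) ℝ) :
    matComm (a • A) (b • B) = (a * b) • matComm A B := by
  simp only [matComm, smul_mul_smul_comm, smul_sub, mul_comm b a]

lemma matComm_neg_swap {n : ℕ} (A B : Matrix (Fin n) (Fin n) ℝ) :
    matComm A B = (-1 : ℝ) • matComm B A := by
  simp [matComm]

lemma frobSq_matComm_comm {n : ℕ} (A B : Matrix (Fin n) (Fin n) ℝ) :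
    frobSq (matComm A B) = frobSq (matComm B A) := by
  rw [matComm_neg_swap, frobSq_smul]; ring

section Conjugation

variable {n : ℕ} {U : Matrix (Fin n) (Fin n) ℝ}

lemma transpose_mul_self_of_mem (hU : U ∈ Matrix.orthogonalGroup (Fin n) ℝ) : Uᵀ * U = 1 :=
  (Matrix.mem_orthogonalGroup_iff' (Fin n) ℝ).1 hU

lemma mul_transpose_self_of_mem (hU : U ∈ Matrix.orthogonalGroup (Fin n) ℝ) : U * Uᵀ = 1 :=
  (Matrix.mem_orthogonalGroup_iff (Fin n) ℝ).1 hU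

lemma conj_mul_conj (hU : U ∈ Matrix.orthogonalGroup (Fin n) ℝ)
    (A B : Matrix (Fin n) (Fin n) ℝ) :
    (Uᵀ * A * U) * (Uᵀ * B * U) = Uᵀ * (A * B) * U := by
  calc _ = Uᵀ * A * (U * Uᵀ) * B * U := by simp only [Matrix.mul_assoc]
    _ = _ := by rw [mul_transpose_self_of_mem hU]; simp only [Matrix.mul_assoc, Matrix.one_mul]

lemma trace_conj (hU : U ∈ Matrix.orthogonalGroup (Fin n) ℝ) (A : Matrix (Fin n) (Fin n) ℝ) :
    (Uᵀ * A * U).trace = A.trace := by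
  rw [Matrix.trace_mul_comm, ← Matrix.mul_assoc, mul_transpose_self_of_mem hU, Matrix.one_mul]

lemma transpose_conj (A : Matrix (Fin n) (Fin n) ℝ) : (Uᵀ * A * U)ᵀ = Uᵀ * Aᵀ * U := by
  simp only [Matrix.transpose_mul, Matrix.transpose_transpose, Matrix.mul_assoc]

lemma frobInner_conj (hU : U ∈ Matrix.orthogonalGroup (Fin n) ℝ)
    (A B : Matrix (Fin n) (Fin n) ℝ) :
    frobInner (Uᵀ * A * U) (Uᵀ * B * U) = frobInner A B := by
  rw [frobInner_eq_trace, transpose_conj, conj_mul_conj hU, trace_conj hU, frobInner_eq_trace]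

lemma frobSq_conj (hU : U ∈ Matrix.orthogonalGroup (Fin n) ℝ) (A : Matrix (Fin n) (Fin n) ℝ) :
    frobSq (Uᵀ * A * U) = frobSq A := by
  rw [frobSq_eq_frobInner, frobInner_conj hU, frobSq_eq_frobInner]

lemma matComm_conj (hU : U ∈ Matrix.orthogonalGroup (Fin n) ℝ)
    (A B : Matrix (Fin n) (Fin n) ℝ) :
    matComm (Uᵀ * A * U) (Uᵀ * B * U) = Uᵀ * matComm A B * U := by
  rw [matComm, conj_mul_conj hU, conj_mul_conj hU, matComm, Matrix.mul_sub, Matrix.sub_mul]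

lemma conj_smul (a : ℝ) (A : Matrix (Fin n) (Fin n) ℝ) :
    Uᵀ * (a • A) * U = a • (Uᵀ * A * U) := by
  rw [Matrix.mul_smul, Matrix.smul_mul]

lemma exists_orthogonal_conj_eq_diagonal {A : Matrix (Fin n) (Fin n) ℝ} (hA : Aᵀ = A) :
    ∃ U ∈ Matrix.orthogonalGroup (Fin n) ℝ, ∃ l : Fin n → ℝ,
      Uᵀ * A * U = Matrix.diagonal l := by
  have hH : A.IsHermitian := by
    rw [Matrix.IsHermitian, Matrix.conjTranspose_eq_transpose_of_trivial, hA]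
  refine ⟨hH.eigenvectorUnitary, hH.eigenvectorUnitary.2, hH.eigenvalues, ?_⟩
  have h := hH.conjStarAlgAut_star_eigenvectorUnitary
  rw [Unitary.conjStarAlgAut_star_apply] at h
  exact h

end Conjugation

section Rotation

variable {n m : ℕ} {R : Matrix (Fin m) (Fin m) ℝ}

lemma sum_frobSq_rotate (hR : R ∈ Matrix.orthogonalGroup (Fin m) ℝ)
    (B : Fin m → Matrix (Fin n) (Fin n) ℝ) :
    ∑ s, frobSq (∑ r, R r s • B r) = ∑ r, frobSq (B r) := by
  have hR' : ∀ p q, ∑ s, R p s * R q s = if p = q then 1 else 0 := fun p q => by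
    have := congrFun (congrFun (mul_transpose_self_of_mem hR) p) q
    simpa [Matrix.mul_apply, Matrix.one_apply] using this
  simp only [frobSq_eq_frobInner, frobInner_sum_smul]
  rw [Finset.sum_comm]
  refine Finset.sum_congr rfl fun p _ => ?_
  rw [Finset.sum_comm]
  simp only [← Finset.sum_mul, hR', ite_mul, one_mul, zero_mul, Finset.sum_ite_eq,
    Finset.mem_univ, if_true]

lemma matComm_sum_right {ι : Type*} (s : Finset ι) (A : Matrix (Fin n) (Fin n) ℝ) (a : ι → ℝ)
    (B : ι → Matrix (Fin n) (Fin n) ℝ) :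
    matComm A (∑ r ∈ s, a r • B r) = ∑ r ∈ s, a r • matComm A (B r) := by
  simp only [matComm, Finset.mul_sum, Finset.sum_mul, Matrix.mul_smul, Matrix.smul_mul, smul_sub,
    Finset.sum_sub_distrib]

lemma sum_frobSq_matComm_rotate (hR : R ∈ Matrix.orthogonalGroup (Fin m) ℝ)
    (B : Fin m → Matrix (Fin n) (Fin n) ℝ) :
    ∑ s, ∑ t, frobSq (matComm (∑ r, R r s • B r) (∑ r, R r t • B r)) =
      ∑ r, ∑ s, frobSq (matComm (B r) (B s)) := by
  simp only [matComm_sum_right]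
  calc _ = ∑ s, ∑ r, frobSq (matComm (∑ q, R q s • B q) (B r)) :=
        Finset.sum_congr rfl fun s _ => sum_frobSq_rotate hR _
    _ = ∑ r, ∑ s, frobSq (matComm (B r) (∑ q, R q s • B q)) := by
        rw [Finset.sum_comm]
        simp only [frobSq_matComm_comm (∑ q, _ • _)]
    _ = _ := by
        simp only [matComm_sum_right]
        exact Finset.sum_congr rfl fun s _ => sum_frobSq_rotate hR _

lemma exists_rotate_pairwise_orthogonal (B : Fin m → Matrix (Fin n) (Fin n) ℝ) :
    ∃ R ∈ Matrix.orthogonalGroup (Fin m) ℝ, ∀ s t, s ≠ t →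
      frobInner (∑ r, R r s • B r) (∑ r, R r t • B r) = 0 := by
  obtain ⟨R, hR, l, h⟩ := exists_orthogonal_conj_eq_diagonal
    (A := Matrix.of fun r s => frobInner (B r) (B s)) (by
      ext r s
      simp only [Matrix.transpose_apply, Matrix.of_apply, frobInner, mul_comm])
  refine ⟨R, hR, fun s t hst => ?_⟩
  have h1 := congrFun (congrFun h s) t
  rw [Matrix.diagonal_apply_ne _ hst] at h1
  rw [← h1, frobInner_sum_smul, Matrix.mul_apply, Finset.sum_comm]
  simp only [Matrix.mul_apply, Finset.sum_mul, Matrix.transpose_apply, Matrix.of_apply]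
  exact Finset.sum_congr rfl fun _ _ => Finset.sum_congr rfl fun _ _ => by ring

end Rotation

/-- Equality analysis in the Schur test for the form `∑ x r * x s * (p r s - q r s)`. -/
lemma schur_test_equality {ι : Type*} [Fintype ι] [DecidableEq ι] (x : ι → ℝ) (p q : ι → ι → ℝ)
    (hx : ∀ r, 0 ≤ x r) (hp : ∀ r s, 0 ≤ p r s) (hq : ∀ r s, 0 ≤ q r s)
    (hps : ∀ r s, p r s = p s r) (hqd : ∀ r, q r r = 1) (hD : ∀ r, ∑ s, p r s ≤ 1)
    (heq : ∑ r, ∑ s, x r * x s * (p r s - q r s) = 0) :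
    ∀ r, 0 < x r → ∑ s, p r s = 1 ∧
      ∀ s, (0 < p r s → x s = x r) ∧ (s ≠ r → 0 < x s → q r s = 0) := by
  have hq' : ∀ r s, 0 ≤ q r s - if r = s then 1 else 0 := fun r s => by
    split_ifs with h
    · rw [← h, hqd]; simp
    · simpa using hq r s
  have e1 : ∑ r, ∑ s, p r s * x r ^ 2 = ∑ r, x r ^ 2 * ∑ s, p r s :=
    Finset.sum_congr rfl fun r _ => by rw [← Finset.sum_mul, mul_comm]
  have e2 : ∑ r, ∑ s, p r s * x s ^ 2 = ∑ r, x r ^ 2 * ∑ s, p r s := by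
    rw [← e1, Finset.sum_comm]
    exact Finset.sum_congr rfl fun r _ => Finset.sum_congr rfl fun s _ => by rw [hps]
  have e3 : ∑ r, ∑ s, x r * x s * (if r = s then (1 : ℝ) else 0) = ∑ r, x r ^ 2 := by
    simp [sq]
  have t1 : ∀ r, 0 ≤ x r ^ 2 * (1 - ∑ s, p r s) := fun r =>
    mul_nonneg (sq_nonneg _) (by linarith [hD r])
  have t2 : ∀ r s, 0 ≤ x r * x s * (q r s - if r = s then 1 else 0) := fun r s =>
    mul_nonneg (mul_nonneg (hx r) (hx s)) (hq' r s)
  have t3 : ∀ r s, 0 ≤ p r s * (x r - x s) ^ 2 := fun r s => mul_nonneg (hp r s) (sq_nonneg _)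
  have key : ∑ r, x r ^ 2 * (1 - ∑ s, p r s)
      + ∑ r, ∑ s, x r * x s * (q r s - if r = s then 1 else 0)
      + (∑ r, ∑ s, p r s * (x r - x s) ^ 2) / 2 = 0 := by
    have k1 : ∑ r, x r ^ 2 * (1 - ∑ s, p r s) = ∑ r, x r ^ 2 - ∑ r, x r ^ 2 * ∑ s, p r s := by
      simp only [mul_sub, mul_one, Finset.sum_sub_distrib]
    have k2 : ∑ r, ∑ s, x r * x s * (q r s - if r = s then 1 else 0) =
        ∑ r, ∑ s, x r * x s * q r s - ∑ r, x r ^ 2 := by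
      rw [← e3]; simp only [mul_sub, Finset.sum_sub_distrib]
    have k3 : ∑ r, ∑ s, p r s * (x r - x s) ^ 2 = ∑ r, ∑ s, p r s * x r ^ 2
        + ∑ r, ∑ s, p r s * x s ^ 2 - 2 * ∑ r, ∑ s, x r * x s * p r s := by
      simp only [Finset.mul_sum, ← Finset.sum_add_distrib, ← Finset.sum_sub_distrib]
      exact Finset.sum_congr rfl fun r _ => Finset.sum_congr rfl fun s _ => by ring
    have k4 : ∑ r, ∑ s, x r * x s * (p r s - q r s) =
        ∑ r, ∑ s, x r * x s * p r s - ∑ r, ∑ s, x r * x s * q r s := by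
      simp only [mul_sub, Finset.sum_sub_distrib]
    linarith
  have s1 := Finset.sum_nonneg fun r (_ : r ∈ Finset.univ) => t1 r
  have s2 := Finset.sum_nonneg fun r (_ : r ∈ Finset.univ) =>
    Finset.sum_nonneg fun s (_ : s ∈ Finset.univ) => t2 r s
  have s3 := Finset.sum_nonneg fun r (_ : r ∈ Finset.univ) =>
    Finset.sum_nonneg fun s (_ : s ∈ Finset.univ) => t3 r s
  have z1 := forall_eq_zero_of_sum_eq_zero t1 (by linarith)
  have z2 := fun r => forall_eq_zero_of_sum_eq_zero (t2 r)
    (forall_eq_zero_of_sum_eq_zero (fun r => Finset.sum_nonneg fun s _ => t2 r s) (by linarith) r)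
  have z3 := fun r => forall_eq_zero_of_sum_eq_zero (t3 r)
    (forall_eq_zero_of_sum_eq_zero (fun r => Finset.sum_nonneg fun s _ => t3 r s) (by linarith) r)
  intro r hr
  refine ⟨?_, fun s => ⟨fun hps' => ?_, fun hsr hs => ?_⟩⟩
  · have := z1 r
    simp only [mul_eq_zero, pow_eq_zero_iff two_ne_zero, hr.ne', false_or] at this
    linarith
  · have := z3 r s
    simp only [mul_eq_zero, pow_eq_zero_iff two_ne_zero, hps'.ne', false_or] at this
    linarith
  · have := z2 r s
    simpa [hr.ne', hs.ne', hsr.symm] using this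

section Spectrum

variable {n : ℕ}

lemma false_of_three_gaps {a b c : ℝ} (h : a ^ 2 + b ^ 2 + c ^ 2 ≤ 1) (hab : 1 < (a - b) ^ 2)
    (hbc : 1 < (b - c) ^ 2) (hac : 1 < (a - c) ^ 2) : False := by
  have h1 : a * b < 0 := by nlinarith [sq_nonneg c]
  have h2 : b * c < 0 := by nlinarith [sq_nonneg a]
  have h3 : a * c < 0 := by nlinarith [sq_nonneg b]
  nlinarith [mul_neg_of_pos_of_neg (mul_pos_of_neg_of_neg h1 h2) h3, sq_nonneg (a * b * c)]

lemma false_of_disjoint_gaps {l : Fin n → ℝ} (hl : ∑ i, l i ^ 2 ≤ 1) {i j p q : Fin n}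
    (hij : 1 < (l i - l j) ^ 2) (hpq : 1 < (l p - l q) ^ 2)
    (hpi : p ≠ i) (hpj : p ≠ j) (hqi : q ≠ i) (hqj : q ≠ j) : False := by
  have hij' : i ≠ j := by rintro rfl; norm_num at hij
  have hpq' : p ≠ q := by rintro rfl; norm_num at hpq
  have h := Finset.sum_le_univ_sum_of_nonneg (s := {i, j, p, q}) fun i => sq_nonneg (l i)
  rw [Finset.sum_insert (by simp [hij', hpi.symm, hqi.symm]),
    Finset.sum_insert (by simp [hpj.symm, hqj.symm]), Finset.sum_pair hpq'] at h
  nlinarith [sq_nonneg (l i + l j), sq_nonneg (l p + l q)]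

lemma exists_center_of_gaps [NeZero n] {l : Fin n → ℝ} (hl : ∑ i, l i ^ 2 ≤ 1) :
    ∃ c, ∀ i j, 1 < (l i - l j) ^ 2 → i = c ∨ j = c := by
  by_contra! hcon
  have hadj : ∀ {i j}, 1 < (l i - l j) ^ 2 → 1 < (l j - l i) ^ 2 := fun h => by
    rwa [← neg_sub, neg_sq]
  obtain ⟨i, j, hij, -, -⟩ := hcon 0
  obtain ⟨p, hjp, hpi⟩ : ∃ p, 1 < (l j - l p) ^ 2 ∧ p ≠ i := by
    obtain ⟨p, q, hpq, hp, hq⟩ := hcon i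
    by_cases hpj : p = j
    · exact ⟨q, hpj ▸ hpq, hq⟩
    by_cases hqj : q = j
    · exact ⟨p, hqj ▸ hadj hpq, hp⟩
    exact (false_of_disjoint_gaps hl hij hpq hp hpj hq hqj).elim
  obtain ⟨q, hiq, hqj⟩ : ∃ q, 1 < (l i - l q) ^ 2 ∧ q ≠ j := by
    obtain ⟨p, q, hpq, hp, hq⟩ := hcon j
    by_cases hpi : p = i
    · exact ⟨q, hpi ▸ hpq, hq⟩
    by_cases hqi : q = i
    · exact ⟨p, hqi ▸ hadj hpq, hp⟩
    exact (false_of_disjoint_gaps hl hij hpq hpi hp hqi hq).elim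
  have hij' : i ≠ j := by rintro rfl; norm_num at hij
  have hiq' : q ≠ i := by rintro rfl; norm_num at hiq
  have hjp' : p ≠ j := by rintro rfl; norm_num at hjp
  by_cases hpq : p = q
  · subst hpq
    have h := Finset.sum_le_univ_sum_of_nonneg (s := {i, j, p}) fun i => sq_nonneg (l i)
    rw [Finset.sum_insert (by simp [hij', hpi.symm]), Finset.sum_pair hqj.symm] at h
    exact false_of_three_gaps (by linarith) hij hjp hiq
  · exact false_of_disjoint_gaps hl hiq hjp hij'.symm hqj.symm hpi hpq

lemma star_identity (l : Fin n → ℝ) (c : Fin n) (L : Finset (Fin n)) (hL : L.Nonempty) :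
    (L.card : ℝ) * ∑ j ∈ L, (l j + l c / L.card) ^ 2
      + (L.card + 1) * (1 - l c ^ 2 - ∑ j ∈ L, l j ^ 2) =
        1 - ∑ j ∈ L, ((l c - l j) ^ 2 - 1) := by
  have hk : (L.card : ℝ) ≠ 0 := by exact_mod_cast hL.card_pos.ne'
  have h1 : ∑ j ∈ L, (l j + l c / L.card) ^ 2 =
      ∑ j ∈ L, l j ^ 2 + 2 * (l c / L.card) * ∑ j ∈ L, l j + L.card * (l c / L.card) ^ 2 := by
    rw [Finset.mul_sum, ← nsmul_eq_mul, ← Finset.sum_const, ← Finset.sum_add_distrib,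
      ← Finset.sum_add_distrib]
    exact Finset.sum_congr rfl fun _ _ => by ring
  have h2 : ∑ j ∈ L, ((l c - l j) ^ 2 - 1) =
      ∑ j ∈ L, l j ^ 2 - 2 * l c * ∑ j ∈ L, l j + L.card * (l c ^ 2 - 1) := by
    rw [Finset.mul_sum, ← nsmul_eq_mul, ← Finset.sum_const, ← Finset.sum_sub_distrib,
      ← Finset.sum_add_distrib]
    exact Finset.sum_congr rfl fun _ _ => by ring
  rw [h1, h2]
  field_simp
  ring

/-- The excess over `1` of the squared gap between two entries of `l`. -/
def gapExcess (l : Fin n → ℝ) (i j : Fin n) : ℝ := max ((l i - l j) ^ 2 - 1) 0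

lemma gapExcess_nonneg (l : Fin n → ℝ) (i j : Fin n) : 0 ≤ gapExcess l i j := le_max_right _ _

lemma gapExcess_self (l : Fin n → ℝ) (i : Fin n) : gapExcess l i i = 0 := by
  simp [gapExcess]

/-- The entries of `l` form the extremal star: one centre `c` and leaves `L` carrying the
opposite weight in equal shares. -/
structure IsStar (l : Fin n → ℝ) (c : Fin n) (L : Finset (Fin n)) : Prop where
  notMem : c ∉ L
  nonempty : L.Nonempty
  leaf : ∀ j ∈ L, l j = -(l c / L.card)
  other : ∀ j ∉ L, j ≠ c → l j = 0
  center : l c ^ 2 + L.card * (l c / L.card) ^ 2 = 1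

lemma sum_gapExcess_le [NeZero n] {l : Fin n → ℝ} (hl : ∑ i, l i ^ 2 ≤ 1) :
    ∑ i, ∑ j, gapExcess l i j ≤ 2 ∧
      (∑ i, ∑ j, gapExcess l i j = 2 → ∃ c L, IsStar l c L) := by
  obtain ⟨c, hc⟩ := exists_center_of_gaps hl
  set L := Finset.univ.filter fun j => 1 < (l c - l j) ^ 2 with hLdef
  have hcL : c ∉ L := by simp [hLdef]
  have hsum : ∑ i, ∑ j, gapExcess l i j = 2 * ∑ j ∈ L, ((l c - l j) ^ 2 - 1) := by
    have hg : ∀ i j, gapExcess l i j = (if i = c then gapExcess l c j else 0)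
        + if j = c then gapExcess l c i else 0 := by
      intro i j
      by_cases hi : i = c <;> by_cases hj : j = c
      · simp [hi, hj, gapExcess_self]
      · simp [hi, hj]
      · simp only [hi, hj, if_true, if_false, zero_add, gapExcess]
        rw [← neg_sub (l c), neg_sq]
      · simp only [hi, hj, if_false, zero_add, gapExcess]
        refine max_eq_right ?_
        by_contra! h
        exact (hc i j (by linarith)).elim hi hj
    have hs : ∑ j, gapExcess l c j = ∑ j ∈ L, ((l c - l j) ^ 2 - 1) := by
      rw [hLdef, Finset.sum_filter]
      refine Finset.sum_congr rfl fun j _ => ?_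
      split_ifs with h
      · exact max_eq_left (by linarith)
      · exact max_eq_right (by linarith)
    rw [Finset.sum_congr rfl fun i _ => Finset.sum_congr rfl fun j _ => hg i j]
    simp only [Finset.sum_add_distrib, Finset.sum_ite_eq', Finset.mem_univ, if_true]
    rw [Finset.sum_comm]
    simp only [Finset.sum_ite_eq', Finset.mem_univ, if_true, hs]
    ring
  have hsplit : ∑ i, l i ^ 2 = l c ^ 2 + ∑ j ∈ L, l j ^ 2 + ∑ j ∈ (insert c L)ᶜ, l j ^ 2 := by
    rw [← Finset.sum_add_sum_compl (insert c L), Finset.sum_insert hcL]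
  have hrest : 0 ≤ ∑ j ∈ (insert c L)ᶜ, l j ^ 2 := Finset.sum_nonneg fun _ _ => sq_nonneg _
  rw [hsum]
  rcases L.eq_empty_or_nonempty with hL | hL
  · simp [hL]
  have hid := star_identity l c L hL
  have hk : (0 : ℝ) < L.card := by exact_mod_cast hL.card_pos
  have hY : 0 ≤ ∑ j ∈ L, (l j + l c / L.card) ^ 2 := Finset.sum_nonneg fun _ _ => sq_nonneg _
  have hW : 0 ≤ 1 - l c ^ 2 - ∑ j ∈ L, l j ^ 2 := by linarith
  have hkY := mul_nonneg hk.le hY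
  have hkW := mul_nonneg (by linarith : (0 : ℝ) ≤ L.card + 1) hW
  refine ⟨by linarith, fun heq => ⟨c, L, ?_⟩⟩
  have hY0 : ∑ j ∈ L, (l j + l c / L.card) ^ 2 = 0 :=
    (mul_eq_zero.1 (by linarith : (L.card : ℝ) * _ = 0)).resolve_left hk.ne'
  have hW0 : 1 - l c ^ 2 - ∑ j ∈ L, l j ^ 2 = 0 :=
    (mul_eq_zero.1 (by linarith : ((L.card : ℝ) + 1) * _ = 0)).resolve_left (by linarith)
  have hleaf : ∀ j ∈ L, l j = -(l c / L.card) := fun j hj => by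
    have := (Finset.sum_eq_zero_iff_of_nonneg fun j _ => sq_nonneg _).1 hY0 j hj
    have := pow_eq_zero_iff two_ne_zero |>.1 this
    linarith
  refine ⟨hcL, hL, hleaf, fun j hj hjc => ?_, ?_⟩
  · have h0 : ∑ j ∈ (insert c L)ᶜ, l j ^ 2 = 0 := by linarith
    have := (Finset.sum_eq_zero_iff_of_nonneg fun j _ => sq_nonneg _).1 h0 j (by simp [hj, hjc])
    exact pow_eq_zero_iff two_ne_zero |>.1 this
  · rw [Finset.sum_congr rfl fun j hj => by rw [hleaf j hj], Finset.sum_const, nsmul_eq_mul,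
      neg_sq] at hW0
    linarith

end Spectrum

section Bessel

variable {n : ℕ} {ι : Type*}

lemma frobSq_matComm_diagonal (l : Fin n → ℝ) (Q : Matrix (Fin n) (Fin n) ℝ) :
    frobSq (matComm (Matrix.diagonal l) Q) = ∑ i, ∑ j, (l i - l j) ^ 2 * Q i j ^ 2 := by
  simp only [frobSq, matComm, Matrix.sub_apply, Matrix.diagonal_mul, Matrix.mul_diagonal]
  exact Finset.sum_congr rfl fun _ _ => Finset.sum_congr rfl fun _ _ => by ring

lemma sq_add_sq_le_frobSq (M : Matrix (Fin n) (Fin n) ℝ) {i j : Fin n} (hij : i ≠ j) :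
    M i j ^ 2 + M j i ^ 2 ≤ frobSq M := by
  have h := Finset.sum_le_univ_sum_of_nonneg (s := {(i, j), (j, i)})
    fun p : Fin n × Fin n => sq_nonneg (M p.1 p.2)
  rw [Finset.sum_pair (by simp [hij]), Fintype.sum_prod_type] at h
  exact h

lemma sum_sq_entry_le_half (J : Finset ι) {Q : ι → Matrix (Fin n) (Fin n) ℝ}
    (hsymm : ∀ s, (Q s)ᵀ = Q s) (hnorm : ∀ s, frobSq (Q s) ≤ 1)
    (horth : ∀ s t, s ≠ t → frobInner (Q s) (Q t) = 0) {i j : Fin n} (hij : i ≠ j) :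
    ∑ s ∈ J, Q s i j ^ 2 ≤ 1 / 2 := by
  classical
  set M := ∑ s ∈ J, Q s i j • Q s with hM
  have hMij : M i j = ∑ s ∈ J, Q s i j ^ 2 := by
    simp only [hM, Matrix.sum_apply, Matrix.smul_apply, smul_eq_mul, sq]
  have hMji : M j i = ∑ s ∈ J, Q s i j ^ 2 := by
    simp only [hM, Matrix.sum_apply, Matrix.smul_apply, smul_eq_mul, sq]
    refine Finset.sum_congr rfl fun s _ => ?_
    rw [← hsymm s, Matrix.transpose_apply, hsymm s]
  have hMn : frobSq M ≤ ∑ s ∈ J, Q s i j ^ 2 := by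
    rw [frobSq_eq_frobInner, hM, frobInner_sum_smul]
    refine Finset.sum_le_sum fun s hs => ?_
    rw [Finset.sum_eq_single_of_mem s hs fun t _ hts => by rw [horth s t hts.symm, mul_zero],
      ← frobSq_eq_frobInner]
    nlinarith [hnorm s, sq_nonneg (Q s i j)]
  have h := sq_add_sq_le_frobSq M hij
  rw [hMij, hMji] at h
  by_contra! hcon
  nlinarith

/-- Sum of commutator norms of a diagonal matrix against an orthonormal family, with the
support of the family in the equality case. -/
lemma sum_frobSq_matComm_diagonal_le [NeZero n] {l : Fin n → ℝ} (hl : ∑ i, l i ^ 2 ≤ 1)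
    (J : Finset ι) {Q : ι → Matrix (Fin n) (Fin n) ℝ}
    (hsymm : ∀ s, (Q s)ᵀ = Q s) (hnorm : ∀ s, frobSq (Q s) ≤ 1)
    (horth : ∀ s t, s ≠ t → frobInner (Q s) (Q t) = 0) :
    ∑ s ∈ J, (frobSq (matComm (Matrix.diagonal l) (Q s)) - 1) ≤ 1 ∧
      (∑ s ∈ J, (frobSq (matComm (Matrix.diagonal l) (Q s)) - 1) = 1 →
        (∃ c L, IsStar l c L) ∧
          ∀ s ∈ J, ∀ i j, (l i - l j) ^ 2 < 1 → Q s i j = 0) := by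
  have h1 : ∀ s, frobSq (matComm (Matrix.diagonal l) (Q s)) - 1 ≤
      ∑ i, ∑ j, ((l i - l j) ^ 2 - 1) * Q s i j ^ 2 := fun s => by
    have := hnorm s
    simp only [sub_mul, one_mul, Finset.sum_sub_distrib, frobSq_matComm_diagonal]
    unfold frobSq at this
    linarith
  have h2 : ∀ s i j, ((l i - l j) ^ 2 - 1) * Q s i j ^ 2 ≤ gapExcess l i j * Q s i j ^ 2 :=
    fun s i j => mul_le_mul_of_nonneg_right (le_max_left _ _) (sq_nonneg _)
  have h3 : ∑ s ∈ J, ∑ i, ∑ j, gapExcess l i j * Q s i j ^ 2 ≤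
      (∑ i, ∑ j, gapExcess l i j) / 2 := by
    rw [Finset.sum_comm, Finset.sum_div]
    refine Finset.sum_le_sum fun i _ => ?_
    rw [Finset.sum_comm, Finset.sum_div]
    refine Finset.sum_le_sum fun j _ => ?_
    rw [← Finset.mul_sum]
    by_cases hij : i = j
    · simp [hij, gapExcess_self]
    · have := mul_le_mul_of_nonneg_left (sum_sq_entry_le_half J hsymm hnorm horth hij)
        (gapExcess_nonneg l i j)
      linarith
  have h12 : ∀ s ∈ J, frobSq (matComm (Matrix.diagonal l) (Q s)) - 1 ≤
      ∑ i, ∑ j, gapExcess l i j * Q s i j ^ 2 := fun s _ => (h1 s).trans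
    (Finset.sum_le_sum fun i _ => Finset.sum_le_sum fun j _ => h2 s i j)
  have hsum := Finset.sum_le_sum h12
  obtain ⟨h4, h5⟩ := sum_gapExcess_le hl
  refine ⟨by linarith, fun heq => ⟨h5 (by linarith), fun s hs i j hij => ?_⟩⟩
  have hs' := (Finset.sum_eq_sum_iff_of_le h12).1 (by linarith) s hs
  have hnn : ∀ i j, 0 ≤ (gapExcess l i j - ((l i - l j) ^ 2 - 1)) * Q s i j ^ 2 := fun i j =>
    mul_nonneg (sub_nonneg.2 (le_max_left _ _)) (sq_nonneg _)
  have hnn' := fun i => Finset.sum_nonneg fun j (_ : j ∈ Finset.univ) => hnn i j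
  have hz : ∑ i, ∑ j, (gapExcess l i j - ((l i - l j) ^ 2 - 1)) * Q s i j ^ 2 = 0 := by
    refine le_antisymm ?_ (Finset.sum_nonneg fun i _ => hnn' i)
    have := h1 s
    simp only [sub_mul (gapExcess l _ _), Finset.sum_sub_distrib]
    linarith
  have := forall_eq_zero_of_sum_eq_zero (hnn i) (forall_eq_zero_of_sum_eq_zero hnn' hz i) j
  rcases mul_eq_zero.1 this with h | h
  · linarith [gapExcess_nonneg l i j]
  · exact pow_eq_zero_iff two_ne_zero |>.1 h

end Bessel

section Extremal

variable {n : ℕ}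

lemma IsStar.card_pos {l : Fin n → ℝ} {c : Fin n} {L : Finset (Fin n)} (h : IsStar l c L) :
    (1 : ℝ) ≤ L.card := by exact_mod_cast h.nonempty.card_pos

lemma IsStar.gap_lt_one {l : Fin n → ℝ} {c : Fin n} {L : Finset (Fin n)} (h : IsStar l c L)
    {i j : Fin n} (hij : i = c ↔ j = c) : (l i - l j) ^ 2 < 1 := by
  by_cases hi : i = c
  · rw [hi, hij.1 hi]; norm_num
  have hj : j ≠ c := fun hj => hi (hij.2 hj)
  have hk := h.card_pos
  have ht : (l c / L.card) ^ 2 < 1 := by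
    have h1 : l c ^ 2 = L.card ^ 2 * (l c / L.card) ^ 2 := by field_simp
    nlinarith [h.center, sq_nonneg (l c / L.card), sq_nonneg (l c)]
  by_cases hiL : i ∈ L <;> by_cases hjL : j ∈ L
  · simp [h.leaf i hiL, h.leaf j hjL]
  · rw [h.leaf i hiL, h.other j hjL hj, sub_zero, neg_sq]; exact ht
  · rw [h.other i hiL hi, h.leaf j hjL, zero_sub, neg_neg]; exact ht
  · simp [h.other i hiL hi, h.other j hjL hj]

lemma trace_cube_eq_zero_of_bipartite {Q : Matrix (Fin n) (Fin n) ℝ} (c : Fin n)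
    (hQ : ∀ i j, (i = c ↔ j = c) → Q i j = 0) : (Q * Q * Q).trace = 0 := by
  simp only [Matrix.trace, Matrix.diag, Matrix.mul_apply, Finset.sum_mul]
  refine Finset.sum_eq_zero fun i _ => Finset.sum_eq_zero fun j _ =>
    Finset.sum_eq_zero fun k _ => ?_
  by_cases hik : i = c ↔ k = c
  · rw [hQ i k hik]; ring
  by_cases hkj : k = c ↔ j = c
  · rw [hQ k j hkj]; ring
  rw [hQ j i (by tauto)]; ring

lemma IsStar.card_eq_one {l : Fin n → ℝ} {c : Fin n} {L : Finset (Fin n)} (h : IsStar l c L)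
    (h0 : ∑ i, l i ^ 3 = 0) : L.card = 1 := by
  have hk := h.card_pos
  have hs : ∑ i, l i ^ 3 = l c ^ 3 + L.card * (-(l c / L.card)) ^ 3 := by
    rw [← Finset.sum_subset (Finset.subset_univ (insert c L)), Finset.sum_insert h.notMem,
      Finset.sum_congr rfl fun j hj => by rw [h.leaf j hj], Finset.sum_const, nsmul_eq_mul]
    intro i _ hi
    simp only [Finset.mem_insert, not_or] at hi
    rw [h.other i hi.2 hi.1]; norm_num
  have hc : l c ≠ 0 := fun hc => by simpa [hc] using h.center
  rw [hs] at h0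
  have h1 : l c ^ 3 * ((L.card : ℝ) ^ 2 - 1) = 0 := by
    field_simp at h0
    linear_combination h0
  have h2 := (mul_eq_zero.1 h1).resolve_left (pow_ne_zero _ hc)
  have h3 : (L.card : ℝ) = 1 := by nlinarith
  exact_mod_cast h3

lemma IsStar.exists_pair {l : Fin n → ℝ} {c : Fin n} {L : Finset (Fin n)} (h : IsStar l c L)
    (h0 : ∑ i, l i ^ 3 = 0) :
    ∃ c d, c ≠ d ∧ l c = √(1 / 2) ∧ l d = -√(1 / 2) ∧ ∀ i, i ≠ c → i ≠ d → l i = 0 := by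
  obtain ⟨d, rfl⟩ := Finset.card_eq_one.1 (h.card_eq_one h0)
  have hcd : c ≠ d := by simpa using h.notMem
  have hd : l d = -l c := by simpa using h.leaf d (by simp)
  have hc : l c ^ 2 = 1 / 2 := by
    have := h.center
    simp only [Finset.card_singleton, Nat.cast_one, div_one, one_mul] at this
    linarith
  have ho : ∀ i, i ≠ c → i ≠ d → l i = 0 := fun i hi hid => h.other i (by simpa using hid) hi
  rcases le_total 0 (l c) with hs | hs
  · have : l c = √(1 / 2) := by rw [← hc, Real.sqrt_sq hs]
    exact ⟨c, d, hcd, this, by rw [hd, this], ho⟩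
  · have : -l c = √(1 / 2) := by rw [← hc, ← neg_sq, Real.sqrt_sq (by linarith)]
    exact ⟨d, c, hcd.symm, by rw [hd, this], by linarith, fun i h1 h2 => ho i h2 h1⟩

lemma frobSq_diagonal (l : Fin n → ℝ) : frobSq (Matrix.diagonal l) = ∑ i, l i ^ 2 := by
  simp [frobSq, Matrix.diagonal_apply]

lemma sum_frobSq_matComm_le [NeZero n] {ι : Type*} {A : Matrix (Fin n) (Fin n) ℝ} (hA : Aᵀ = A)
    (hA1 : frobSq A ≤ 1) (J : Finset ι) {Q : ι → Matrix (Fin n) (Fin n) ℝ}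
    (hsymm : ∀ s, (Q s)ᵀ = Q s) (hnorm : ∀ s, frobSq (Q s) ≤ 1)
    (horth : ∀ s t, s ≠ t → frobInner (Q s) (Q t) = 0) :
    ∑ s ∈ J, (frobSq (matComm A (Q s)) - 1) ≤ 1 ∧
      (∑ s ∈ J, (frobSq (matComm A (Q s)) - 1) = 1 →
        ∃ U ∈ Matrix.orthogonalGroup (Fin n) ℝ, ∃ l c L, Uᵀ * A * U = Matrix.diagonal l ∧
          IsStar l c L ∧ ∀ s ∈ J, ∀ i j, (l i - l j) ^ 2 < 1 → (Uᵀ * Q s * U) i j = 0) := by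
  obtain ⟨U, hU, l, hl⟩ := exists_orthogonal_conj_eq_diagonal hA
  have hl1 : ∑ i, l i ^ 2 ≤ 1 := by rwa [← frobSq_diagonal, ← hl, frobSq_conj hU]
  have hc : ∀ s, frobSq (matComm (Matrix.diagonal l) (Uᵀ * Q s * U)) =
      frobSq (matComm A (Q s)) := fun s => by
    rw [← hl, matComm_conj hU, frobSq_conj hU]
  obtain ⟨h1, h2⟩ := sum_frobSq_matComm_diagonal_le hl1 J (Q := fun s => Uᵀ * Q s * U)
    (fun s => by rw [transpose_conj, hsymm]) (fun s => by rw [frobSq_conj hU]; exact hnorm s)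
    (fun s t hst => by rw [frobInner_conj hU, horth s t hst])
  simp only [hc] at h1 h2
  refine ⟨h1, fun heq => ?_⟩
  obtain ⟨⟨c, L, hstar⟩, hsupp⟩ := h2 heq
  exact ⟨U, hU, l, c, L, hl, hstar, hsupp⟩

/-- The symmetric matrix with entry `1` at `(c, d)` and `(d, c)` and `0` elsewhere. -/
def edgeMatrix (c d : Fin n) : Matrix (Fin n) (Fin n) ℝ :=
  Matrix.of fun i j => if (i = c ∧ j = d) ∨ (i = d ∧ j = c) then 1 else 0

lemma frobInner_edgeMatrix {c d : Fin n} (hcd : c ≠ d) (A : Matrix (Fin n) (Fin n) ℝ) :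
    frobInner (edgeMatrix c d) A = A c d + A d c := by
  have : frobInner (edgeMatrix c d) A =
      ∑ p : Fin n × Fin n, edgeMatrix c d p.1 p.2 * A p.1 p.2 := by
    rw [Fintype.sum_prod_type]; rfl
  rw [this, ← Finset.sum_subset (Finset.subset_univ {(c, d), (d, c)}),
    Finset.sum_pair (by simp [hcd])]
  · simp [edgeMatrix]
  · rintro ⟨i, j⟩ _ h
    simp only [Finset.mem_insert, Prod.mk.injEq, Finset.mem_singleton] at h
    simp [edgeMatrix, h]

/-- The commutator of `diagonal l`, with `l` supported on `c, d`, against a matrix vanishing at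
`(c, d)` is small. -/
lemma frobSq_matComm_diagonal_le_half {l : Fin n → ℝ} {c d : Fin n}
    (hc : l c = √(1 / 2)) (hd : l d = -√(1 / 2)) (ho : ∀ i, i ≠ c → i ≠ d → l i = 0)
    {A : Matrix (Fin n) (Fin n) ℝ} (hcd : A c d = 0) (hdc : A d c = 0) :
    frobSq (matComm (Matrix.diagonal l) A) ≤ 1 / 2 * frobSq A := by
  rw [frobSq_matComm_diagonal, frobSq, Finset.mul_sum]
  have ha : √(1 / 2 : ℝ) ^ 2 = 1 / 2 := Real.sq_sqrt (by norm_num)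
  refine Finset.sum_le_sum fun i _ => ?_
  rw [Finset.mul_sum]
  refine Finset.sum_le_sum fun j _ => ?_
  by_cases h : (i = c ∧ j = d) ∨ (i = d ∧ j = c)
  · rcases h with ⟨rfl, rfl⟩ | ⟨rfl, rfl⟩
    · simp [hcd]
    · simp [hdc]
  · refine mul_le_mul_of_nonneg_right ?_ (sq_nonneg _)
    by_cases hic : i = c <;> by_cases hid : i = d <;> by_cases hjc : j = c <;>
      by_cases hjd : j = d <;> simp_all

lemma gap_lt_one_of_pair {l : Fin n → ℝ} {c d : Fin n}
    (hc : l c = √(1 / 2)) (hd : l d = -√(1 / 2)) (ho : ∀ i, i ≠ c → i ≠ d → l i = 0)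
    {i j : Fin n} (h : ¬((i = c ∧ j = d) ∨ (i = d ∧ j = c))) : (l i - l j) ^ 2 < 1 := by
  have ha : √(1 / 2 : ℝ) ^ 2 = 1 / 2 := Real.sq_sqrt (by norm_num)
  have hb : (1 / 2 : ℝ) < 1 := by norm_num
  by_cases hic : i = c <;> by_cases hid : i = d <;> by_cases hjc : j = c <;>
      by_cases hjd : j = d <;> simp_all

/-- An orthogonal family attaining equality has at most two nonzero members, simultaneously
conjugate to a multiple of the standard pair. -/
lemma exists_standard_pair [NeZero n] {m : ℕ} (T : Fin m → Matrix (Fin n) (Fin n) ℝ)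
    (hsymm : ∀ r, (T r)ᵀ = T r) (horth : ∀ r s, r ≠ s → frobInner (T r) (T s) = 0)
    (heq : ∑ r, ∑ s, frobSq (matComm (T r) (T s)) = (∑ r, frobSq (T r)) ^ 2)
    {r : Fin m} (hr : T r ≠ 0) :
    ∃ s, s ≠ r ∧ (∀ t, t ≠ r → t ≠ s → T t = 0) ∧
      ∃ U ∈ Matrix.orthogonalGroup (Fin n) ℝ, ∃ c d, c ≠ d ∧ ∃ μ : ℝ, 0 ≤ μ ∧
        (∃ l : Fin n → ℝ, Uᵀ * T r * U = Matrix.diagonal l ∧ l c = μ ∧ l d = -μ ∧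
          ∀ i, i ≠ c → i ≠ d → l i = 0) ∧
        ∃ ε : ℝ, ε ^ 2 = 1 ∧ Uᵀ * T s * U = (ε * μ) • edgeMatrix c d := by
  set x : Fin m → ℝ := fun r => frobSq (T r) with hxdef
  have hx : ∀ r, 0 ≤ x r := fun r => frobSq_nonneg _
  set Q : Fin m → Matrix (Fin n) (Fin n) ℝ := fun r => (√(x r))⁻¹ • T r with hQdef
  have hTQ : ∀ r, T r = √(x r) • Q r := fun r => by
    rcases (hx r).eq_or_lt with h | h
    · rw [← h, frobSq_eq_zero h.symm]; simp
    · rw [hQdef, smul_smul, mul_inv_cancel₀ (Real.sqrt_pos.2 h).ne', one_smul]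
  have hQ1 : ∀ r, 0 < x r → frobSq (Q r) = 1 := fun r h => by
    rw [hQdef, frobSq_smul, inv_pow, Real.sq_sqrt h.le]
    exact inv_mul_cancel₀ h.ne'
  have hQn : ∀ r, frobSq (Q r) ≤ 1 := fun r => by
    rcases (hx r).eq_or_lt with h | h
    · rw [hQdef, frobSq_smul, ← h]; simp
    · exact (hQ1 r h).le
  have hQs : ∀ r, (Q r)ᵀ = Q r := fun r => by rw [hQdef, Matrix.transpose_smul, hsymm]
  have hQo : ∀ r s, r ≠ s → frobInner (Q r) (Q s) = 0 := fun r s h => by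
    simp only [hQdef, frobInner_smul_smul, horth r s h, mul_zero]
  set C : Fin m → Fin m → ℝ := fun r s => frobSq (matComm (Q r) (Q s)) with hC
  have hCs : ∀ r s, C r s = C s r := fun r s => frobSq_matComm_comm _ _
  have hTC : ∀ r s, frobSq (matComm (T r) (T s)) = x r * x s * C r s := fun r s => by
    rw [hTQ r, hTQ s, matComm_smul_smul, frobSq_smul, mul_pow, Real.sq_sqrt (hx r),
      Real.sq_sqrt (hx s)]
  set J : Fin m → Finset (Fin m) := fun r => Finset.univ.filter fun s => 1 < C r s with hJ
  have hJp : ∀ r, ∑ s, max (C r s - 1) 0 = ∑ s ∈ J r, (frobSq (matComm (Q r) (Q s)) - 1) :=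
      fun r => by
    rw [hJ, Finset.sum_filter]
    refine Finset.sum_congr rfl fun s _ => ?_
    split_ifs with h
    · exact max_eq_left (by linarith)
    · exact max_eq_right (by linarith)
  have hschur := schur_test_equality x (fun r s => max (C r s - 1) 0)
    (fun r s => max (-(C r s - 1)) 0) hx (fun _ _ => le_max_right _ _)
    (fun _ _ => le_max_right _ _) (fun r s => by simp only [hCs r s])
    (fun r => by simp [hC, matComm, frobSq])
    (fun r => by
      rw [hJp]
      exact (sum_frobSq_matComm_le (hQs r) (hQn r) (J r) hQs hQn hQo).1)
    (by
      simp only [max_zero_sub_max_neg_zero_eq_self, mul_sub, mul_one, Finset.sum_sub_distrib,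
        ← hTC, heq, sq, Finset.sum_mul_sum]
      exact sub_self _)
  have hstruct := fun r (h : 0 < x r) =>
    (sum_frobSq_matComm_le (hQs r) (hQn r) (J r) hQs hQn hQo).2
      (by rw [← hJp]; exact (hschur r h).1)
  have hJne : ∀ r, 0 < x r → ∃ s, 1 < C r s ∧ x s = x r := fun r h => by
    have h1 := (hschur r h).1
    obtain ⟨s, -, hs⟩ := Finset.exists_ne_zero_of_sum_ne_zero (by rw [h1]; exact one_ne_zero)
    have hs' := lt_of_le_of_ne (le_max_right (C r s - 1) 0) (Ne.symm hs)
    refine ⟨s, ?_, ((hschur r h).2 s).1 hs'⟩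
    rcases lt_max_iff.1 hs' with h2 | h2
    · linarith
    · exact absurd h2 (lt_irrefl _)
  have hcube : ∀ r, 0 < x r → (Q r * Q r * Q r).trace = 0 := fun r h => by
    obtain ⟨s, hs, hxs⟩ := hJne r h
    obtain ⟨U, hU, l, c, L, -, hstar, hsupp⟩ := hstruct s (hxs ▸ h)
    rw [← trace_conj hU, ← conj_mul_conj hU, ← conj_mul_conj hU]
    exact trace_cube_eq_zero_of_bipartite c fun i j hij =>
      hsupp r (by simpa [hJ, hCs s r] using hs) i j (hstar.gap_lt_one hij)
  have hxr : 0 < x r := lt_of_le_of_ne (hx r) fun h => hr (frobSq_eq_zero h.symm)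
  obtain ⟨s, hs, hxs⟩ := hJne r hxr
  obtain ⟨U, hU, l, c₀, L, hdiag, hstar, hsupp⟩ := hstruct r hxr
  have hl3 : ∑ i, l i ^ 3 = 0 := by
    have := hcube r hxr
    rw [← trace_conj hU, ← conj_mul_conj hU, ← conj_mul_conj hU, hdiag,
      Matrix.diagonal_mul_diagonal, Matrix.diagonal_mul_diagonal, Matrix.trace_diagonal] at this
    rw [← this]
    exact Finset.sum_congr rfl fun _ _ => by ring
  obtain ⟨c, d, hcd, hc, hd, ho⟩ := hstar.exists_pair hl3
  have hsr : s ≠ r := by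
    rintro rfl
    simp [hC, matComm, frobSq] at hs
    linarith
  have hconjs : ∀ t, (Uᵀ * Q t * U)ᵀ = Uᵀ * Q t * U := fun t => by rw [transpose_conj, hQs]
  set q := (Uᵀ * Q s * U) c d with hq
  have hQsU : Uᵀ * Q s * U = q • edgeMatrix c d := by
    ext i j
    by_cases h : (i = c ∧ j = d) ∨ (i = d ∧ j = c)
    · rcases h with ⟨rfl, rfl⟩ | ⟨rfl, rfl⟩
      · simp [edgeMatrix, hq]
      · rw [← hconjs, Matrix.transpose_apply]; simp [edgeMatrix, hq]
    · rw [hsupp s (by simpa [hJ] using hs) i j (gap_lt_one_of_pair hc hd ho h)]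
      simp [edgeMatrix, h]
  have hq2 : q ^ 2 = 1 / 2 := by
    have h1 := hQ1 s (hxs ▸ hxr)
    rw [← frobSq_conj hU, hQsU, frobSq_smul, frobSq_eq_frobInner, frobInner_edgeMatrix hcd] at h1
    simp [edgeMatrix] at h1
    linarith
  have ha : √(1 / 2 : ℝ) ^ 2 = 1 / 2 := Real.sq_sqrt (by norm_num)
  have ha0 : (0 : ℝ) < √(1 / 2) := Real.sqrt_pos.2 (by norm_num)
  refine ⟨s, hsr, fun t htr hts => ?_, U, hU, c, d, hcd, √(x r) * √(1 / 2), by positivity,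
    ⟨√(x r) • l, ?_, ?_, ?_, ?_⟩, q / √(1 / 2), ?_, ?_⟩
  · by_contra hT
    have hxt : 0 < x t := lt_of_le_of_ne (hx t) fun h => hT (frobSq_eq_zero h.symm)
    have h1 : 1 ≤ C r t := by
      have := ((hschur r hxr).2 t).2 htr hxt
      have := le_max_left (-(C r t - 1)) 0
      linarith
    have h2 : (Uᵀ * Q t * U) d c = (Uᵀ * Q t * U) c d := by
      rw [← hconjs, Matrix.transpose_apply, hconjs]
    have h3 : (Uᵀ * Q t * U) c d = 0 := by
      have h := hQo s t hts.symm
      have hsm := frobInner_smul_smul q 1 (edgeMatrix c d) (Uᵀ * Q t * U)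
      rw [one_smul, ← hQsU, frobInner_conj hU, h, frobInner_edgeMatrix hcd, h2] at hsm
      have hq0 : q ≠ 0 := fun h => by norm_num [h] at hq2
      have := (mul_eq_zero.1 hsm.symm).resolve_left (by simpa using hq0)
      linarith
    have h4 := frobSq_matComm_diagonal_le_half hc hd ho h3 (h2.trans h3)
    rw [← hdiag, matComm_conj hU, frobSq_conj hU, frobSq_conj hU] at h4
    have := hQn t
    have : C r t ≤ 1 / 2 * frobSq (Q t) := h4
    linarith
  · rw [hTQ r, conj_smul, hdiag, Matrix.diagonal_smul]
  · simp [hc]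
  · simp [hd]
  · intro i hi hi'
    simp [ho i hi hi']
  · rw [div_pow, hq2, ha]; norm_num
  · rw [hTQ s, conj_smul, hQsU, hxs, smul_smul]
    congr 1
    field_simp

end Extremal

section Normalization

lemma exists_perm_zero_one {k : ℕ} (hk : 2 ≤ k) {a b : Fin k} (hab : a ≠ b) :
    ∃ σ : Equiv.Perm (Fin k), σ ⟨0, by omega⟩ = a ∧ σ ⟨1, by omega⟩ = b := by
  set z : Fin k := ⟨0, by omega⟩
  set o : Fin k := ⟨1, by omega⟩
  have hzo : z ≠ o := by simp [z, o]
  refine ⟨Equiv.swap z a * Equiv.swap o (Equiv.swap z a b), ?_, by simp⟩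
  have h : Equiv.swap z a b ≠ z := fun h => hab <| by
    rw [Equiv.swap_apply_eq_iff, Equiv.swap_apply_left] at h
    exact h.symm
  rw [Equiv.Perm.mul_apply, Equiv.swap_apply_of_ne_of_ne hzo h.symm, Equiv.swap_apply_left]

lemma submatrix_mem_orthogonalGroup {k : ℕ} {U : Matrix (Fin k) (Fin k) ℝ}
    (hU : U ∈ Matrix.orthogonalGroup (Fin k) ℝ) (σ : Equiv.Perm (Fin k)) :
    U.submatrix id σ ∈ Matrix.orthogonalGroup (Fin k) ℝ := by
  rw [Matrix.mem_orthogonalGroup_iff', Matrix.transpose_submatrix,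
    ← Matrix.submatrix_mul _ _ _ _ _ Function.bijective_id, transpose_mul_self_of_mem hU,
    Matrix.submatrix_one_equiv]

lemma diagonal_mem_orthogonalGroup {k : ℕ} {δ : Fin k → ℝ} (hδ : ∀ i, δ i ^ 2 = 1) :
    Matrix.diagonal δ ∈ Matrix.orthogonalGroup (Fin k) ℝ := by
  rw [Matrix.mem_orthogonalGroup_iff', Matrix.diagonal_transpose,
    Matrix.diagonal_mul_diagonal]
  simp only [← sq, hδ, Matrix.diagonal_one]

lemma conj_submatrix {n : ℕ} (U A : Matrix (Fin n) (Fin n) ℝ) (σ : Equiv.Perm (Fin n)) :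
    (U.submatrix id σ)ᵀ * A * U.submatrix id σ = (Uᵀ * A * U).submatrix σ σ := by
  ext i j
  simp [Matrix.mul_apply]

lemma sum_smul_conj {n m : ℕ} (P : Matrix (Fin n) (Fin n) ℝ) (a : Fin m → ℝ)
    (B : Fin m → Matrix (Fin n) (Fin n) ℝ) :
    ∑ r, a r • (Pᵀ * B r * P) = Pᵀ * (∑ r, a r • B r) * P := by
  simp only [Finset.mul_sum, Finset.sum_mul, Matrix.mul_smul, Matrix.smul_mul]

lemma H1_eq_diagonal (n : ℕ) (μ : ℝ) : H1 n μ = Matrix.diagonal fun i : Fin n =>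
    if (i : ℕ) = 0 then μ else if (i : ℕ) = 1 then -μ else 0 := by
  ext i j
  by_cases h : i = j
  · simp [H1, h]
  · have : (i : ℕ) ≠ j := fun h' => h (Fin.ext h')
    rw [Matrix.diagonal_apply_ne _ h, H1, Matrix.of_apply, if_neg (by omega), if_neg (by omega)]

lemma H2_zero (n : ℕ) : H2 n 0 = 0 := by
  ext i j
  simp [H2]

/-- The standard tuple `H₁(μ), H₂(μ), 0, …, 0` attains equality. -/
lemma standard_tuple_equality {n m : ℕ} (hn : 2 ≤ n) (hm : 2 ≤ m) (μ : ℝ)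
    (C : Fin m → Matrix (Fin n) (Fin n) ℝ)
    (hC : C = fun s : Fin m =>
      if (s : ℕ) = 0 then H1 n μ else if (s : ℕ) = 1 then H2 n μ else 0) :
    ∑ r, ∑ s, frobSq (matComm (C r) (C s)) = (∑ r, frobSq (C r)) ^ 2 := by
  obtain ⟨n, rfl⟩ := Nat.exists_eq_add_of_le' hn
  obtain ⟨m, rfl⟩ := Nat.exists_eq_add_of_le' hm
  have h1 : frobSq (H1 (n + 2) μ) = 2 * μ ^ 2 := by
    rw [H1_eq_diagonal, frobSq_diagonal]
    simp [Fin.sum_univ_succ]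
    ring
  have h2 : frobSq (H2 (n + 2) μ) = 2 * μ ^ 2 := by
    simp [frobSq, H2, Fin.sum_univ_succ]
    ring
  have h12 : frobSq (matComm (H1 (n + 2) μ) (H2 (n + 2) μ)) = 8 * μ ^ 4 := by
    rw [H1_eq_diagonal, frobSq_matComm_diagonal]
    simp [H2, Fin.sum_univ_succ]
    ring
  have h21 := frobSq_matComm_comm (H2 (n + 2) μ) (H1 (n + 2) μ)
  have h0 : frobSq (0 : Matrix (Fin (n + 2)) (Fin (n + 2)) ℝ) = 0 := by simp [frobSq]
  have hl : ∀ A : Matrix (Fin (n + 2)) (Fin (n + 2)) ℝ, matComm 0 A = 0 := by simp [matComm]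
  have hr : ∀ A : Matrix (Fin (n + 2)) (Fin (n + 2)) ℝ, matComm A 0 = 0 := by simp [matComm]
  have hs : ∀ A : Matrix (Fin (n + 2)) (Fin (n + 2)) ℝ, matComm A A = 0 := by simp [matComm]
  subst hC
  simp only [Fin.sum_univ_succ, Fin.val_zero, Fin.val_succ]
  simp [h0, h1, h2, h12, h21, hl, hr, hs]
  ring

end Normalization

/-- Equality characterization in the DDVV matrix inequality for symmetric matrices. -/
theorem ddvv_symmetric_equality (n m : ℕ) (hn : 2 ≤ n) (hm : 2 ≤ m)
    (B : Fin m → Matrix (Fin n) (Fin n) ℝ)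
    (hsymm : ∀ r, (B r)ᵀ = B r) :
    (∑ r, ∑ s, frobSq (matComm (B r) (B s)) = (∑ r, frobSq (B r)) ^ 2) ↔
      ∃ P ∈ Matrix.orthogonalGroup (Fin n) ℝ, ∃ R ∈ Matrix.orthogonalGroup (Fin m) ℝ,
        ∃ μ : ℝ, 0 ≤ μ ∧
          (fun s : Fin m => ∑ r, R r s • (Pᵀ * B r * P)) =
            fun s : Fin m =>
              if (s : ℕ) = 0 then H1 n μ
              else if (s : ℕ) = 1 then H2 n μ
              else 0 := by
  constructor
  · intro heq
    obtain ⟨R, hR, horth⟩ := exists_rotate_pairwise_orthogonal B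
    set T : Fin m → Matrix (Fin n) (Fin n) ℝ := fun s => ∑ r, R r s • B r with hT
    by_cases hT0 : ∀ r, T r = 0
    · refine ⟨1, one_mem _, R, hR, 0, le_rfl, funext fun s => ?_⟩
      rw [sum_smul_conj]
      change 1ᵀ * T s * 1 = _
      simp [hT0, H1_eq_diagonal, H2_zero]
    push Not at hT0
    obtain ⟨r, hr⟩ := hT0
    have : NeZero n := ⟨by omega⟩
    obtain ⟨s, hsr, hother, U, hU, c, d, hcd, μ, hμ, ⟨l, hl, hlc, hld, hlo⟩, ε, hε, hs⟩ :=
      exists_standard_pair T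
        (fun r => by simp only [hT, Matrix.transpose_sum, Matrix.transpose_smul, hsymm]) horth
        (by rw [sum_frobSq_matComm_rotate hR, sum_frobSq_rotate hR, heq]) hr
    obtain ⟨σ, hσ0, hσ1⟩ := exists_perm_zero_one hn hcd
    obtain ⟨τ, hτ0, hτ1⟩ := exists_perm_zero_one hm hsr.symm
    refine ⟨U.submatrix id σ, submatrix_mem_orthogonalGroup hU σ,
      R.submatrix id τ * Matrix.diagonal fun t : Fin m => if (t : ℕ) = 1 then ε else 1,
      mul_mem (submatrix_mem_orthogonalGroup hR τ) (diagonal_mem_orthogonalGroup fun t => by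
        split_ifs <;> simp [hε]), μ, hμ, funext fun t => ?_⟩
    have hσc : ∀ i : Fin n, σ i = c ↔ (i : ℕ) = 0 := fun i => by
      rw [← hσ0, σ.apply_eq_iff_eq, Fin.ext_iff]
    have hσd : ∀ i : Fin n, σ i = d ↔ (i : ℕ) = 1 := fun i => by
      rw [← hσ1, σ.apply_eq_iff_eq, Fin.ext_iff]
    have hTt : ∑ p, (R.submatrix id τ * Matrix.diagonal fun t : Fin m =>
        if (t : ℕ) = 1 then ε else 1) p t • B p = (if (t : ℕ) = 1 then ε else 1) • T (τ t) := by
      simp only [Matrix.mul_diagonal, Matrix.submatrix_apply, id, hT, Finset.smul_sum, smul_smul,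
        mul_comm]
    rw [sum_smul_conj, hTt, conj_smul, conj_submatrix]
    split_ifs with h1 h0 h0
    · omega
    · have : τ t = s := by rw [← hτ1]; exact congrArg τ (Fin.ext h1)
      rw [this, hs]
      ext i j
      simp only [Matrix.smul_apply, Matrix.submatrix_apply, edgeMatrix, H2, Matrix.of_apply, hσc,
        hσd, smul_eq_mul]
      split_ifs
      · linear_combination μ * hε
      · ring
    · have : τ t = r := by rw [← hτ0]; exact congrArg τ (Fin.ext h0)
      rw [this, hl, one_smul, H1_eq_diagonal, Matrix.submatrix_diagonal_equiv]
      congr 1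
      funext i
      simp only [Function.comp_apply]
      split_ifs with hi hi'
      · rw [(hσc i).2 hi, hlc]
      · rw [(hσd i).2 hi', hld]
      · exact hlo _ (mt (hσc i).1 hi) (mt (hσd i).1 hi')
    · have : T (τ t) = 0 := hother _
        (fun h => h0 (congrArg Fin.val (τ.injective (h.trans hτ0.symm))))
        (fun h => h1 (congrArg Fin.val (τ.injective (h.trans hτ1.symm))))
      simp [this]
  · rintro ⟨P, hP, R, hR, μ, -, hC⟩
    have h := standard_tuple_equality hn hm μ _ hC
    rw [sum_frobSq_matComm_rotate hR, sum_frobSq_rotate hR] at h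
    simpa only [matComm_conj hP, frobSq_conj hP] using h
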